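/- arXiv:1202.5524 — 4 statements merged into one kernel-verified Lean document; each statement's English description precedes it below -/
import Mathlib

section
/- Let U ⊆ ℝⁿ be an open set, x ∈ U, and let φ : U → ℝⁿ be differentiable at x. Suppose there exist an open neighbourhood U_x ⊆ U of x and C¹ maps ξ^1, …, ξ^n, each ξ^i defined on an open subset of ℝⁿ, a diffeomorphism onto its image which changes only the i-th coordinate (i.e. (ξ^i(y))_j = y_j for all j ≠ i), such that φ = ξ^1 ∘ ξ^2 ∘ … ∘ ξ^n on U_x (with the compositions defined). Then for every i ∈ {1,…,n} the determinant of the lower-right (n−i+1)×(n−i+1) submatrix (∂φ_j/∂x_k)_{i ≤ j ≤ n, i ≤ k ≤ n} of the Jacobian matrix of φ at x is nonzero. -/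
/-- A differentiable map with a local left inverse that is differentiable at the image point has
injective derivative. -/
theorem HasFDerivAt.injective_of_eventually_leftInverse
    {E F : Type*} [NormedAddCommGroup E] [NormedSpace ℝ E] [NormedAddCommGroup F]
    [NormedSpace ℝ F] {f : E → F} {g : F → E} {f' : E →L[ℝ] F} {p : E}
    (hf : HasFDerivAt f f' p) (hg : DifferentiableAt ℝ g (f p))
    (hgf : ∀ᶠ y in nhds p, g (f y) = y) : Function.Injective f' := by
  have hid : HasFDerivAt (g ∘ f) (ContinuousLinearMap.id ℝ E) p :=
    (hasFDerivAt_id p).congr_of_eventuallyEq hgf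
  have h := (hg.hasFDerivAt.comp p hf).unique hid
  exact Function.LeftInverse.injective fun v => by simpa using DFunLike.congr_fun h v

/-- Two differentiable maps whose `j`-th coordinates agree near `x` have derivatives with the same
`j`-th coordinate. -/
theorem HasFDerivAt.apply_eq_of_eventually_apply_eq
    {E ι : Type*} [NormedAddCommGroup E] [NormedSpace ℝ E] [Fintype ι]
    {f g : E → ι → ℝ} {f' g' : E →L[ℝ] (ι → ℝ)} {x : E} {j : ι}
    (hf : HasFDerivAt f f' x) (hg : HasFDerivAt g g' x)
    (h : ∀ᶠ y in nhds x, f y j = g y j) (v : E) : f' v j = g' v j := by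
  have hfj := hasFDerivAt_pi'.1 hf j
  have hgj := (hasFDerivAt_pi'.1 hg j).congr_of_eventuallyEq h
  simpa using DFunLike.congr_fun (hfj.unique hgj) v

/-- A principal block of the matrix of `A` is nonsingular if, on that block's rows, `A` agrees with
an injective map `T` that preserves all the remaining coordinates. -/
theorem det_block_ne_zero_of_injective {ι : Type*} [Fintype ι] [DecidableEq ι]
    {s : ι → Prop} [DecidablePred s] [Fintype {m // s m}] [DecidableEq {m // s m}]
    {A T : (ι → ℝ) →L[ℝ] (ι → ℝ)} (hT : Function.Injective T)
    (hfix : ∀ v j, ¬ s j → T v j = v j) (hAT : ∀ v j, s j → A v j = T v j) :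
    (Matrix.of fun j k : {m // s m} =>
      A (Pi.single (k : ι) 1) (j : ι)).det ≠ 0 := by
  intro hdet
  obtain ⟨w, hw, hw0⟩ := Matrix.exists_mulVec_eq_zero_iff.2 hdet
  set v : ι → ℝ := ∑ k : {m // s m}, w k • Pi.single (k : ι) (1 : ℝ) with hv
  have hvs (j : {m // s m}) : v j = w j := by
    simp [hv, Finset.sum_apply, Pi.single_apply, Subtype.coe_inj]
  have hvn (j : ι) (hj : ¬ s j) : v j = 0 := by
    rw [hv, Finset.sum_apply]
    refine Finset.sum_eq_zero fun k _ => ?_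
    have : j ≠ k := fun h => hj (h ▸ k.2)
    simp [this]
  have hTv : T v = 0 := by
    ext j
    by_cases hj : s j
    · rw [← hAT v j hj, hv]
      simpa [Matrix.mulVec, dotProduct, Finset.sum_apply, mul_comm] using congrFun hw0 ⟨j, hj⟩
    · rw [hfix v j hj, hvn j hj, Pi.zero_apply]
  have hv0 : v = 0 := hT (by rw [hTv, map_zero])
  exact hw (funext fun j => by rw [← hvs j, hv0]; rfl)

/-- Conversely, if `φ`, differentiable at `x ∈ U_x ⊆ U`, decomposes on the open
neighbourhood `U_x` of `x` as `φ = ξ^1 ∘ ⋯ ∘ ξ^n` where each `ξ^k` is a `C¹` map on an open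
set `W k`, a diffeomorphism onto its image, changing only the `k`-th coordinate (and the
compositions are defined: the tail composition `ξ^{k+1} ∘ ⋯ ∘ ξ^n` maps `U_x` into `W k`),
then every trailing minor of the Jacobian of `φ` at `x` is nonzero. -/
theorem minors_nonzero_of_decomposition
    (n : ℕ) (U : Set (Fin n → ℝ)) (hU : IsOpen U)
    (x : Fin n → ℝ) (hx : x ∈ U)
    (φ : (Fin n → ℝ) → (Fin n → ℝ)) (hφ : DifferentiableAt ℝ φ x)
    (Ux : Set (Fin n → ℝ)) (hUxU : Ux ⊆ U) (hUxopen : IsOpen Ux) (hxUx : x ∈ Ux)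
    (W : Fin n → Set (Fin n → ℝ)) (hWopen : ∀ k, IsOpen (W k))
    (ξ : Fin n → (Fin n → ℝ) → (Fin n → ℝ))
    (hC1 : ∀ k, ContDiffOn ℝ 1 (ξ k) (W k))
    (hinj : ∀ k, Set.InjOn (ξ k) (W k))
    (himg : ∀ k, IsOpen (ξ k '' W k))
    (hinv : ∀ k, ContDiffOn ℝ 1 (Function.invFunOn (ξ k) (W k)) (ξ k '' W k))
    (hcoord : ∀ k, ∀ y ∈ W k, ∀ j : Fin n, j ≠ k → ξ k y j = y j)
    (hdom : ∀ k : Fin n, ∀ y ∈ Ux,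
      ((List.ofFn ξ).drop ((k : ℕ) + 1)).foldr (· ∘ ·) id y ∈ W k)
    (hcomp : ∀ y ∈ Ux, φ y = (List.ofFn ξ).foldr (· ∘ ·) id y) :
    ∀ i : Fin n,
      (Matrix.of fun j k : {m : Fin n // i ≤ m} =>
        fderiv ℝ φ x (Pi.single (k : Fin n) 1) (j : Fin n)).det ≠ 0 := by
  intro i
  set t : ℕ → (Fin n → ℝ) → (Fin n → ℝ) :=
    fun m => ((List.ofFn ξ).drop m).foldr (· ∘ ·) id with ht
  have hstep (k : Fin n) (y) : t k y = ξ k (t (k + 1) y) := by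
    have hk : (k : ℕ) < (List.ofFn ξ).length := by simp
    simp only [ht]
    rw [List.drop_eq_getElem_cons hk]
    simp
  have htn : t n = id := by simp [ht, List.drop_eq_nil_of_le]
  have hnear : ∀ᶠ y in nhds x, y ∈ Ux := hUxopen.mem_nhds hxUx
  have htail : ∀ m ≤ n, (∃ L : (Fin n → ℝ) →L[ℝ] (Fin n → ℝ),
      HasFDerivAt (t m) L x ∧ Function.Injective L) ∧
      ∀ y ∈ Ux, ∀ j : Fin n, (j : ℕ) < m → t m y j = y j := by
    intro m hm
    induction hm using Nat.decreasingInduction with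
    | self =>
      rw [htn]
      exact ⟨⟨_, hasFDerivAt_id x, Function.injective_id⟩, fun _ _ _ _ => rfl⟩
    | of_succ m hmn ih =>
      obtain ⟨⟨L, hL, hLinj⟩, hfix⟩ := ih
      let k : Fin n := ⟨m, hmn⟩
      have hp : t (m + 1) x ∈ W k := hdom k x hxUx
      have hWp := (hWopen k).mem_nhds hp
      have hξ := (((hC1 k).contDiffAt hWp).differentiableAt one_ne_zero).hasFDerivAt
      have hinv' := ((hinv k).contDiffAt
        ((himg k).mem_nhds (Set.mem_image_of_mem _ hp))).differentiableAt one_ne_zero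
      have hξinj := hξ.injective_of_eventually_leftInverse hinv'
        (Filter.eventually_of_mem hWp fun y hy => (hinj k).leftInvOn_invFunOn hy)
      have htm : t m = ξ k ∘ t (m + 1) := funext (hstep k)
      refine ⟨⟨_ ∘L L, htm ▸ hξ.comp x hL, hξinj.comp hLinj⟩, fun y hy j hj => ?_⟩
      rw [show t m y = _ from hstep k y,
        hcoord k _ (hdom k y hy) j (fun h => by simp [h, k] at hj)]
      exact hfix y hy j (by lia)
  have hhead : ∀ m ≤ (i : ℕ), ∀ y ∈ Ux, ∀ j : Fin n, i ≤ j → t 0 y j = t m y j := by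
    intro m hm y hy j hj
    induction m with
    | zero => rfl
    | succ m ih =>
      let k : Fin n := ⟨m, by lia⟩
      rw [ih (by lia), show t m y = _ from hstep k y]
      refine hcoord k _ (hdom k y hy) j fun h => ?_
      have : (i : ℕ) ≤ m := by simpa [h, k, Fin.le_def] using hj
      lia
  obtain ⟨⟨T, hT, hTinj⟩, hfix⟩ := htail i i.2.le
  refine det_block_ne_zero_of_injective hTinj (fun v j hj => ?_) (fun v j hj => ?_)
  · exact hT.apply_eq_of_eventually_apply_eq (hasFDerivAt_id x)
      (hnear.mono fun y hy => hfix y hy j (by simpa using hj)) v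
  · exact hφ.hasFDerivAt.apply_eq_of_eventually_apply_eq hT
      (hnear.mono fun y hy => (congrFun (hcomp y hy) j).trans (hhead i le_rfl y hy j hj)) v
end

section
/- Let U ⊆ ℝⁿ be an open set, φ : U → ℝⁿ a C¹ map, x ∈ U, and suppose that for each i ∈ {1,…,n} the i-th trailing Jacobian minor det_i(x) := det (∂φ_j/∂x_l)_{i ≤ j ≤ n, i ≤ l ≤ n}(x) is nonzero (with the convention det_{n+1}(x) := 1). Let φ = ξ^1 ∘ … ∘ ξ^n be the (unique) local decomposition near x with each ξ^k a C¹ diffeomorphism changing only the k-th coordinate, so that ξ^k is defined near the point A_{k+1}(x) := (x_1,…,x_k, φ_{k+1}(x),…,φ_n(x)). Then for each k ∈ {1,…,n}, the k-th partial derivative of the k-th component of ξ^k satisfies (∂ξ^k_k/∂y_k)(A_{k+1}(x)) = det_k(x) / det_{k+1}(x). -/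
/-- The map replacing the coordinates of `y` of index at least `m` by those of `φ y`. -/
def replaceTail {n : ℕ} (φ : (Fin n → ℝ) → (Fin n → ℝ)) (m : ℕ) (y : Fin n → ℝ) : Fin n → ℝ :=
  fun j => if (j : ℕ) < m then y j else φ y j

/-- The Jacobian matrix of `replaceTail φ m`, in terms of the derivative `L` of `φ`. -/
def replaceTailMatrix {n : ℕ} (L : (Fin n → ℝ) →L[ℝ] (Fin n → ℝ)) (m : ℕ) :
    Matrix (Fin n) (Fin n) ℝ :=
  Matrix.of fun j l => if (j : ℕ) < m then (1 : Matrix (Fin n) (Fin n) ℝ) j l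
    else L (Pi.single l 1) j

theorem det_replaceTailMatrix_of_lt {n : ℕ} (L : (Fin n → ℝ) →L[ℝ] (Fin n → ℝ)) {m : ℕ}
    (h : m < n) :
    (replaceTailMatrix L m).det =
      (Matrix.of fun j l : {p : Fin n // (⟨m, h⟩ : Fin n) ≤ p} =>
        L (Pi.single (l : Fin n) 1) (j : Fin n)).det := by
  have hlt : ∀ i : Fin n, ¬ (⟨m, h⟩ : Fin n) ≤ i → (i : ℕ) < m := fun i hi => by
    simpa [Fin.le_def] using hi
  rw [Matrix.twoBlockTriangular_det _ (fun i : Fin n => (⟨m, h⟩ : Fin n) ≤ i)]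
  · have h₁ : (replaceTailMatrix L m).toSquareBlockProp (fun i : Fin n => ¬ (⟨m, h⟩ : Fin n) ≤ i)
        = 1 := by
      ext i j
      simp [Matrix.toSquareBlockProp, replaceTailMatrix, hlt i i.2, Matrix.one_apply,
        Subtype.ext_iff]
    rw [h₁, Matrix.det_one, mul_one]
    congr 1
    ext i j
    have hi : ¬ ((i : Fin n) : ℕ) < m := not_lt.mpr i.2
    simp [Matrix.toSquareBlockProp, replaceTailMatrix, hi]
  · intro i hi j hj
    have hij : i ≠ j := by rintro rfl; exact hi hj
    simp [replaceTailMatrix, hlt i hi, Matrix.one_apply, hij]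

theorem det_replaceTailMatrix_of_le {n : ℕ} (L : (Fin n → ℝ) →L[ℝ] (Fin n → ℝ)) {m : ℕ}
    (h : n ≤ m) : (replaceTailMatrix L m).det = 1 := by
  have : replaceTailMatrix L m = 1 := by
    ext i j
    simp [replaceTailMatrix, i.2.trans_le h]
  rw [this, Matrix.det_one]

theorem HasFDerivAt.exists_replaceTail {n : ℕ} {φ : (Fin n → ℝ) → (Fin n → ℝ)}
    {L : (Fin n → ℝ) →L[ℝ] (Fin n → ℝ)} {x : Fin n → ℝ} (h : HasFDerivAt φ L x) (m : ℕ) :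
    ∃ L' : (Fin n → ℝ) →L[ℝ] (Fin n → ℝ), HasFDerivAt (replaceTail φ m) L' x ∧
      LinearMap.toMatrix' (L' : (Fin n → ℝ) →ₗ[ℝ] (Fin n → ℝ)) = replaceTailMatrix L m := by
  refine ⟨ContinuousLinearMap.pi fun j => if (j : ℕ) < m then ContinuousLinearMap.proj j
    else (ContinuousLinearMap.proj j).comp L, ?_, ?_⟩
  · rw [hasFDerivAt_pi]
    intro j
    by_cases hj : (j : ℕ) < m
    · simpa only [replaceTail, hj, if_true] using hasFDerivAt_apply (𝕜 := ℝ) j x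
    · simpa only [replaceTail, hj, if_false] using hasFDerivAt_pi'.1 h j
  · ext i j
    by_cases hi : (i : ℕ) < m <;>
      simp [LinearMap.toMatrix'_apply, replaceTailMatrix, hi, Matrix.one_apply, Pi.single_apply]

/-- The Jacobian determinant of a map changing only the `k`-th coordinate is the `k`-th partial
derivative of its `k`-th component. -/
theorem det_fderiv_of_eventually_apply_eq {n : ℕ} {f : (Fin n → ℝ) → (Fin n → ℝ)}
    {p : Fin n → ℝ} {k : Fin n} (hf : DifferentiableAt ℝ f p)
    (h : ∀ᶠ y in nhds p, ∀ j, j ≠ k → f y j = y j) :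
    (LinearMap.toMatrix' (fderiv ℝ f p : (Fin n → ℝ) →ₗ[ℝ] (Fin n → ℝ))).det =
      fderiv ℝ f p (Pi.single k 1) k := by
  have hrow : ∀ j, j ≠ k → ∀ v, fderiv ℝ f p v j = v j := by
    intro j hj v
    have h₁ := hasFDerivAt_pi'.1 hf.hasFDerivAt j
    have h₂ : HasFDerivAt (fun y => f y j)
        (ContinuousLinearMap.proj j : (Fin n → ℝ) →L[ℝ] ℝ) p :=
      (hasFDerivAt_apply (𝕜 := ℝ) j p).congr_of_eventuallyEq (h.mono fun y hy => hy j hj)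
    exact DFunLike.congr_fun (h₁.unique h₂) v
  have hM : LinearMap.toMatrix' (fderiv ℝ f p : (Fin n → ℝ) →ₗ[ℝ] (Fin n → ℝ)) =
      (1 : Matrix (Fin n) (Fin n) ℝ).updateRow k fun l => fderiv ℝ f p (Pi.single l 1) k := by
    ext i j
    by_cases hi : i = k
    · subst hi
      simp [LinearMap.toMatrix'_apply]
    · simp [LinearMap.toMatrix'_apply, hi, hrow i hi, Matrix.one_apply, Pi.single_apply]
  rw [hM, ← Matrix.cramer_transpose_apply, Matrix.transpose_one, Matrix.cramer_one]
  rfl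

theorem foldr_comp_drop_ofFn {n : ℕ} {α : Type*} (ξ : Fin n → α → α) (k : Fin n) (y : α) :
    ((List.ofFn ξ).drop k).foldr (· ∘ ·) id y =
      ξ k (((List.ofFn ξ).drop ((k : ℕ) + 1)).foldr (· ∘ ·) id y) := by
  rw [List.drop_eq_getElem_cons (by simp)]
  simp

/-- If each `ξ k` changes only the `k`-th coordinate, the partial compositions of the `ξ k` keep
the leading coordinates and agree with the full composition on the trailing ones. -/
theorem foldr_comp_drop_ofFn_eq_replaceTail {n : ℕ} {φ : (Fin n → ℝ) → (Fin n → ℝ)}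
    {ξ : Fin n → (Fin n → ℝ) → (Fin n → ℝ)} {y : Fin n → ℝ}
    (hξ : ∀ k j : Fin n, j ≠ k →
      ξ k (((List.ofFn ξ).drop ((k : ℕ) + 1)).foldr (· ∘ ·) id y) j =
        ((List.ofFn ξ).drop ((k : ℕ) + 1)).foldr (· ∘ ·) id y j)
    (hφ : φ y = (List.ofFn ξ).foldr (· ∘ ·) id y) {m : ℕ} (hm : m ≤ n) :
    ((List.ofFn ξ).drop m).foldr (· ∘ ·) id y = replaceTail φ m y := by
  have step : ∀ m (hm : m < n) (j : Fin n), (j : ℕ) ≠ m →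
      ((List.ofFn ξ).drop m).foldr (· ∘ ·) id y j =
        ((List.ofFn ξ).drop (m + 1)).foldr (· ∘ ·) id y j := by
    intro m hm j hj
    rw [foldr_comp_drop_ofFn ξ ⟨m, hm⟩ y]
    exact hξ ⟨m, hm⟩ j (fun h => hj (congrArg Fin.val h))
  have tail : ∀ m ≤ n, ∀ j : Fin n, m ≤ j →
      ((List.ofFn ξ).drop m).foldr (· ∘ ·) id y j = φ y j := by
    intro m
    induction m with
    | zero => intro _ j _; rw [hφ, List.drop_zero]
    | succ m ih =>
      intro hm j hj
      rw [← step m hm j (by omega), ih (by omega) j (by omega)]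
  have head : ∀ j : Fin n, (j : ℕ) < m →
      ((List.ofFn ξ).drop m).foldr (· ∘ ·) id y j = y j := by
    induction hm using Nat.decreasingInduction with
    | self => intro j _; rw [List.drop_eq_nil_of_le (by simp)]; rfl
    | of_succ m hm ih =>
      intro j hj
      rw [step m hm j hj.ne, ih j (by omega)]
  ext j
  by_cases hj : (j : ℕ) < m
  · simpa only [replaceTail, hj, if_true] using head j hj
  · simpa only [replaceTail, hj, if_false] using tail m hm j (not_lt.1 hj)


/-- Let `φ` be `C¹` on the open set `U ⊆ ℝⁿ`, `x ∈ U`, and suppose all trailing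
Jacobian minors `det_i(x)` of `φ` at `x` are nonzero (here `detm m`, `m = 0, …, n−1`, is the
determinant of the lower-right submatrix of the Jacobian with rows and columns `≥ m`, with
the convention `detm n = 1`).  If `φ = ξ^1 ∘ ⋯ ∘ ξ^n` is the local decomposition near `x`
with each `ξ^k` a `C¹` diffeomorphism changing only the `k`-th coordinate, defined near the
point `A_{k+1}(x) = (x_1, …, x_k, φ_{k+1}(x), …, φ_n(x))`, then
`(∂ξ^k_k/∂y_k)(A_{k+1}(x)) = det_k(x) / det_{k+1}(x)`. -/
theorem derivative_of_factor
    (n : ℕ) (U : Set (Fin n → ℝ)) (hU : IsOpen U)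
    (φ : (Fin n → ℝ) → (Fin n → ℝ)) (hφ : ContDiffOn ℝ 1 φ U)
    (x : Fin n → ℝ) (hx : x ∈ U)
    (detm : ℕ → ℝ)
    (hdetm : ∀ m : ℕ, detm m = if h : m < n then
        (Matrix.of fun j l : {p : Fin n // (⟨m, h⟩ : Fin n) ≤ p} =>
          fderiv ℝ φ x (Pi.single (l : Fin n) 1) (j : Fin n)).det
      else 1)
    (hminor : ∀ m : ℕ, detm m ≠ 0)
    (Ux : Set (Fin n → ℝ)) (hUxU : Ux ⊆ U) (hUxopen : IsOpen Ux) (hxUx : x ∈ Ux)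
    (W : Fin n → Set (Fin n → ℝ)) (hWopen : ∀ k, IsOpen (W k))
    (ξ : Fin n → (Fin n → ℝ) → (Fin n → ℝ))
    (hC1 : ∀ k, ContDiffOn ℝ 1 (ξ k) (W k))
    (hinj : ∀ k, Set.InjOn (ξ k) (W k))
    (hinv : ∀ k, ContDiffOn ℝ 1 (Function.invFunOn (ξ k) (W k)) (ξ k '' W k))
    (hcoord : ∀ k, ∀ y ∈ W k, ∀ j : Fin n, j ≠ k → ξ k y j = y j)
    (hA : ∀ k : Fin n,
      (fun j : Fin n => if (j : ℕ) < (k : ℕ) + 1 then x j else φ x j) ∈ W k)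
    (hdom : ∀ k : Fin n, ∀ y ∈ Ux,
      ((List.ofFn ξ).drop ((k : ℕ) + 1)).foldr (· ∘ ·) id y ∈ W k)
    (hcomp : ∀ y ∈ Ux, φ y = (List.ofFn ξ).foldr (· ∘ ·) id y)
    (k : Fin n) :
    fderiv ℝ (ξ k) (fun j : Fin n => if (j : ℕ) < (k : ℕ) + 1 then x j else φ x j)
        (Pi.single k 1) k = detm k / detm ((k : ℕ) + 1) := by
  have hdet : ∀ m, detm m = (replaceTailMatrix (fderiv ℝ φ x) m).det := by
    intro m
    rw [hdetm]
    split_ifs with h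
    · exact (det_replaceTailMatrix_of_lt _ h).symm
    · exact (det_replaceTailMatrix_of_le _ (not_lt.1 h)).symm
  have hT : ∀ y ∈ Ux, ∀ m ≤ n,
      ((List.ofFn ξ).drop m).foldr (· ∘ ·) id y = replaceTail φ m y := fun y hy m hm =>
    foldr_comp_drop_ofFn_eq_replaceTail
      (fun k j hj => hcoord k _ (hdom k y hy) j hj) (hcomp y hy) hm
  have hcompA : ξ k ∘ replaceTail φ ((k : ℕ) + 1) =ᶠ[nhds x] replaceTail φ k := by
    filter_upwards [hUxopen.mem_nhds hxUx] with y hy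
    rw [Function.comp_apply, ← hT y hy _ k.2, ← hT y hy _ k.2.le, foldr_comp_drop_ofFn]
  have hφx : HasFDerivAt φ (fderiv ℝ φ x) x :=
    ((hφ.contDiffAt (hU.mem_nhds hx)).differentiableAt one_ne_zero).hasFDerivAt
  obtain ⟨L₀, hL₀, hM₀⟩ := hφx.exists_replaceTail k
  obtain ⟨L₁, hL₁, hM₁⟩ := hφx.exists_replaceTail ((k : ℕ) + 1)
  change fderiv ℝ (ξ k) (replaceTail φ ((k : ℕ) + 1) x) (Pi.single k 1) k = _
  have hW : W k ∈ nhds (replaceTail φ ((k : ℕ) + 1) x) := (hWopen k).mem_nhds (hA k)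
  have hξ : DifferentiableAt ℝ (ξ k) (replaceTail φ ((k : ℕ) + 1) x) :=
    ((hC1 k).contDiffAt hW).differentiableAt one_ne_zero
  have hL : L₀ = (fderiv ℝ (ξ k) (replaceTail φ ((k : ℕ) + 1) x)).comp L₁ :=
    hL₀.unique ((hξ.hasFDerivAt.comp x hL₁).congr_of_eventuallyEq hcompA.symm)
  rw [eq_div_iff (hminor _), hdet, hdet, ← hM₀, ← hM₁, hL, ContinuousLinearMap.toLinearMap_comp,
    LinearMap.toMatrix'_comp, Matrix.det_mul, det_fderiv_of_eventually_apply_eq hξ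
      (Filter.mem_of_superset hW fun y hy => hcoord k y hy)]
end

section
/- For every ε > 0 there exist y ∈ ℝ and t with 0 < t < ε such that the vector (−sin((y−t)²), 0, cos((y−t)²)) ∈ ℝ³ lies in the linear span of the two vectors (cos(y²), 0, sin(y²)) and (0, 1, 0). (Consequently, for the distributions Δ^H(x,y,z) = span{(cos(y²),0,sin(y²)), (0,1,0)} and Δ^V(x,y,z) = span{(−sin(y²),0,cos(y²))} on ℝ³, and the flow φ_t(x,y,z) = (x, y+t, z) of the horizontal vector field e₂ (whose derivative is the identity), there are points p_n and times t_n → 0 with (φ_{t_n})_* Δ^V(φ_{t_n}^{-1}(p_n)) ⊆ Δ^H(p_n), so the pair (Δ^H, Δ^V) does not preserve transversality along the group generated by horizontal vector fields.) -/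
open Real

/-- For every `ε > 0` there exist `y ∈ ℝ` and `0 < t < ε` such that the vector
`(−sin((y−t)²), 0, cos((y−t)²)) ∈ ℝ³` lies in the span of `(cos(y²), 0, sin(y²))` and
`(0, 1, 0)`; i.e. transversality of the pair of distributions `Δ^H`, `Δ^V` of Example 1
degenerates along the flow of the horizontal vector field `e₂` at arbitrarily small times. -/
theorem transversality_degenerates (ε : ℝ) (hε : 0 < ε) :
    ∃ y t : ℝ, 0 < t ∧ t < ε ∧
      (![-sin ((y - t) ^ 2), 0, cos ((y - t) ^ 2)] : Fin 3 → ℝ) ∈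
        Submodule.span ℝ
          ({![cos (y ^ 2), 0, sin (y ^ 2)], ![0, 1, 0]} : Set (Fin 3 → ℝ)) := by
  obtain ⟨t, ht, htε⟩ := exists_between hε
  refine ⟨(t ^ 2 - π / 2) / (2 * t), t, ht, htε, ?_⟩
  set y := (t ^ 2 - π / 2) / (2 * t) with hy
  have hsq : (y - t) ^ 2 = y ^ 2 + π / 2 := by
    rw [hy]
    field_simp
    ring
  rw [hsq, sin_add_pi_div_two, cos_add_pi_div_two, Submodule.mem_span_pair]
  exact ⟨-1, 0, by simp⟩
end

section
/- Let b > 0 and let g : [0, b) → ℝ be a differentiable function with g(0) = 0 and g′(t) = −1 − g(t)² for all t ∈ [0, b). Then g(t) = −tan t for all t ∈ [0, b), and necessarily b ≤ π/2. In particular, no solution of this initial value problem extends to the interval [0, π/2], i.e. the equation explodes at time π/2, and g(t) → −∞ as t → (π/2)⁻ when b = π/2. -/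
open Real Filter

/-- Along a solution of `g' = −1 − g²` with `g 0 = 0`, the function `arctan ∘ g` decreases with
unit speed. -/
lemma arctan_eq_neg_of_riccati {b : ℝ} {g : ℝ → ℝ} (hg0 : g 0 = 0)
    (hg : ∀ t ∈ Set.Ico (0 : ℝ) b, HasDerivWithinAt g (-1 - g t ^ 2) (Set.Ico (0 : ℝ) b) t)
    {t : ℝ} (ht : t ∈ Set.Ico (0 : ℝ) b) : arctan (g t) = -t := by
  have hderiv : ∀ s ∈ Set.Ico (0 : ℝ) b,
      HasDerivWithinAt (fun s => arctan (g s) + s) 0 (Set.Ico (0 : ℝ) b) s := by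
    intro s hs
    have hpos : 1 + g s ^ 2 ≠ 0 := by positivity
    refine ((hg s hs).arctan.add (hasDerivWithinAt_id s _)).congr_deriv ?_
    field_simp
    ring
  have h0 : (0 : ℝ) ∈ Set.Ico (0 : ℝ) b := ⟨le_rfl, ht.1.trans_lt ht.2⟩
  have hconst := (convex_Ico (0 : ℝ) b).norm_image_sub_le_of_norm_hasDerivWithin_le
    (C := 0) hderiv (fun _ _ => by simp) h0 ht
  rw [zero_mul, norm_le_zero_iff, hg0, arctan_zero] at hconst
  linarith

/-- If `g : [0, b) → ℝ` is differentiable with `g 0 = 0` and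
`g' t = −1 − (g t)²` on `[0, b)` (with `b > 0`), then `g t = −tan t` on `[0, b)`,
necessarily `b ≤ π/2` (the solution explodes at time `π/2`), and if `b = π/2` then
`g t → −∞` as `t → (π/2)⁻`. -/
theorem riccati_explosion (b : ℝ) (hb : 0 < b) (g : ℝ → ℝ) (hg0 : g 0 = 0)
    (hg : ∀ t ∈ Set.Ico (0 : ℝ) b, HasDerivWithinAt g (-1 - g t ^ 2) (Set.Ico (0 : ℝ) b) t) :
    (∀ t ∈ Set.Ico (0 : ℝ) b, g t = -tan t) ∧ b ≤ π / 2 ∧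
      (b = π / 2 → Tendsto g (nhdsWithin (π / 2) (Set.Iio (π / 2))) atBot) := by
  have htan : ∀ t ∈ Set.Ico (0 : ℝ) b, g t = -tan t := fun t ht => by
    rw [← tan_neg, ← arctan_eq_neg_of_riccati hg0 hg ht, tan_arctan]
  refine ⟨htan, ?_, ?_⟩
  · by_contra! hlt
    have harctan := arctan_eq_neg_of_riccati hg0 hg ⟨pi_div_two_pos.le, hlt⟩
    exact (neg_pi_div_two_lt_arctan (g (π / 2))).ne' harctan
  · rintro rfl
    refine (tendsto_neg_atTop_atBot.comp tendsto_tan_pi_div_two).congr' ?_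
    filter_upwards [Ioo_mem_nhdsLT hb] with t ht
    exact (htan t ⟨ht.1.le, ht.2⟩).symm
end
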